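/- Let G : [0,∞) → [0,∞) be C³ on [0,∞) with G(0) = 0, G′(0) = 1, G′(x) > 0 and 0 ≤ G(x) ≤ x for all x ≥ 0, and suppose G satisfies the functional equation G(2x) = 2·G(G(x)) for all x ≥ 0. Then for every x₀ > 0 such that the iterates G^[j](x₀) tend to 0 as j → ∞, the Schwarzian derivative of G vanishes at x₀: S(G)(x₀) = G′′′(x₀)/G′(x₀) − (3/2)·(G′′(x₀)/G′(x₀))² = 0. -/

import Mathlib

open Filter Set Topology

noncomputable section

/-- Differentiating `G (2 x) = 2 G (G x)` three times turns it into the transformation rule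
`4 S(2x) = S(x) + S(G x) G'(x)²` for the Schwarzian derivative `S`. -/
lemma schwarzian_doubling {G g₁ g₂ g₃ : ℝ → ℝ}
    (h₁ : ∀ x > 0, HasDerivAt G (g₁ x) x) (h₂ : ∀ x > 0, HasDerivAt g₁ (g₂ x) x)
    (h₃ : ∀ x > 0, HasDerivAt g₂ (g₃ x) x) (hg₁ : ∀ x > 0, 0 < g₁ x)
    (hG : ∀ x > 0, 0 < G x) (hfe : ∀ x > 0, G (2 * x) = 2 * G (G x)) {x : ℝ} (hx : 0 < x) :
    4 * (g₃ (2 * x) / g₁ (2 * x) - (3 / 2) * (g₂ (2 * x) / g₁ (2 * x)) ^ 2) =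
      (g₃ x / g₁ x - (3 / 2) * (g₂ x / g₁ x) ^ 2) +
        (g₃ (G x) / g₁ (G x) - (3 / 2) * (g₂ (G x) / g₁ (G x)) ^ 2) * g₁ x ^ 2 := by
  have hasDerivAt_double {f f' : ℝ → ℝ} (hf : ∀ x > 0, HasDerivAt f (f' x) x) {x : ℝ}
      (hx : 0 < x) : HasDerivAt (fun x => f (2 * x)) (f' (2 * x) * 2) x := by
    have h := (hasDerivAt_id x).const_mul 2
    simp only [mul_one, id_eq] at h
    exact HasDerivAt.comp x (hf (2 * x) (by positivity)) h
  have hasDerivAt_comp {f f' : ℝ → ℝ} (hf : ∀ x > 0, HasDerivAt f (f' x) x) {x : ℝ}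
      (hx : 0 < x) : HasDerivAt (fun x => f (G x)) (f' (G x) * g₁ x) x :=
    HasDerivAt.comp x (hf (G x) (hG x hx)) (h₁ x hx)
  have unique {u v : ℝ → ℝ} {a b x : ℝ} (hx : 0 < x) (hu : HasDerivAt u a x)
      (hv : HasDerivAt v b x) (huv : ∀ x > 0, u x = v x) : a = b :=
    hu.unique (hv.congr_of_eventuallyEq ((eventually_gt_nhds hx).mono huv))
  have e₁ : ∀ x > 0, g₁ (2 * x) = g₁ (G x) * g₁ x := fun x hx => by
    linarith [unique hx (hasDerivAt_double h₁ hx) ((hasDerivAt_comp h₁ hx).const_mul 2) hfe]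
  have e₂ : ∀ x > 0, g₂ (2 * x) * 2 = g₂ (G x) * g₁ x * g₁ x + g₁ (G x) * g₂ x :=
    fun x hx =>
      unique hx (hasDerivAt_double h₂ hx) ((hasDerivAt_comp h₂ hx).mul (h₂ x hx)) e₁
  have e₃ := unique hx ((hasDerivAt_double h₃ hx).mul_const 2)
    ((((hasDerivAt_comp h₃ hx).mul (h₂ x hx)).mul (h₂ x hx)).add
      ((hasDerivAt_comp h₂ hx).mul (h₃ x hx))) e₂
  have d₂ : g₂ (2 * x) = (g₂ (G x) * g₁ x * g₁ x + g₁ (G x) * g₂ x) / 2 := by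
    linarith [e₂ x hx]
  have d₃ : g₃ (2 * x) =
      (g₃ (G x) * g₁ x ^ 3 + 3 * g₂ (G x) * g₁ x * g₂ x + g₁ (G x) * g₃ x) / 4 := by
    simp only [Pi.mul_apply] at e₃
    linear_combination e₃ / 4
  have := (hg₁ x hx).ne'
  have := (hg₁ (G x) (hG x hx)).ne'
  rw [e₁ x hx, d₂, d₃]
  field_simp
  ring

/-- A function bounded near `0` that satisfies `4 s(2x) = s(x) + s(G x) c(x)²`, where `G x ≤ x`
and `c` is close to `1` near `0`, vanishes on `(0, ∞)`. -/
lemma eq_zero_of_doubling {s G c : ℝ → ℝ} {a M : ℝ} (ha : 0 < a)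
    (hG : ∀ x > 0, 0 < G x ∧ G x ≤ x) (hs : ∀ x > 0, 4 * s (2 * x) = s x + s (G x) * c x ^ 2)
    (hM : ∀ x > 0, x ≤ a → |s x| ≤ M) (hc : ∀ x > 0, x ≤ a → c x ^ 2 ≤ 2) :
    ∀ x > 0, s x = 0 := by
  have decay : ∀ n : ℕ, ∀ x > 0, x ≤ a → |s x| ≤ M * (3 / 4) ^ n := by
    intro n
    induction n with
    | zero => simpa using hM
    | succ n ih =>
      intro x hx hxa
      have hy : 0 < x / 2 := by positivity
      have hya : x / 2 ≤ a := by linarith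
      obtain ⟨hGy, hGle⟩ := hG _ hy
      have b₁ := ih _ hy hya
      have b₂ := ih _ hGy (hGle.trans hya)
      have e := hs _ hy
      rw [mul_div_cancel₀ x two_ne_zero] at e
      have b₃ : |s (G (x / 2)) * c (x / 2) ^ 2| ≤ M * (3 / 4) ^ n * 2 := by
        rw [abs_mul, abs_of_nonneg (sq_nonneg (c (x / 2)))]
        exact mul_le_mul b₂ (hc _ hy hya) (sq_nonneg _) ((abs_nonneg _).trans b₂)
      rw [abs_le] at b₁ b₃ ⊢
      rw [pow_succ]
      constructor <;> linarith
  have near_zero : ∀ x > 0, x ≤ a → s x = 0 := by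
    intro x hx hxa
    have hlim : Tendsto (fun n : ℕ => M * (3 / 4 : ℝ) ^ n) atTop (𝓝 (M * 0)) :=
      (tendsto_pow_atTop_nhds_zero_of_lt_one (by norm_num) (by norm_num)).const_mul M
    rw [mul_zero] at hlim
    exact abs_nonpos_iff.1 (ge_of_tendsto' hlim fun n => decay n x hx hxa)
  have spread : ∀ n : ℕ, ∀ x > 0, x ≤ a * 2 ^ n → s x = 0 := by
    intro n
    induction n with
    | zero => simpa using near_zero
    | succ n ih =>
      intro x hx hxa
      have hy : 0 < x / 2 := by positivity
      have hya : x / 2 ≤ a * 2 ^ n := by rw [pow_succ] at hxa; linarith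
      obtain ⟨hGy, hGle⟩ := hG _ hy
      have e := hs _ hy
      rw [mul_div_cancel₀ x two_ne_zero, ih _ hy hya, ih _ hGy (hGle.trans hya)] at e
      linarith
  intro x hx
  obtain ⟨n, hn⟩ := pow_unbounded_of_one_lt (x / a) one_lt_two
  exact spread n x hx ((div_le_iff₀' ha).1 hn.le)

lemma ContDiffOn.hasDerivAt_derivWithin_Ici {f : ℝ → ℝ} {n : WithTop ℕ∞} {b x : ℝ}
    (hf : ContDiffOn ℝ n f (Ici b)) (hn : n ≠ 0) (hx : b < x) :
    HasDerivAt f (derivWithin f (Ici b) x) x :=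
  ((hf.differentiableOn hn x hx.le).hasDerivWithinAt).hasDerivAt (Ici_mem_nhds hx)

/-- If `G : [0,∞) → [0,∞)` is `C³` with `G(0) = 0`, `G′(0) = 1`, positive derivative,
`0 ≤ G(x) ≤ x`, and satisfies `G(2x) = 2·G(G(x))`, then the Schwarzian derivative of `G`
vanishes at every `x₀ > 0` whose forward `G`-orbit tends to `0`. -/
theorem schwarzian_vanishes
    (G : ℝ → ℝ)
    (hGdiff : ContDiffOn ℝ 3 G (Set.Ici 0))
    (hG0 : G 0 = 0)
    (hG'0 : derivWithin G (Set.Ici 0) 0 = 1)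
    (hG' : ∀ x ∈ Set.Ici (0 : ℝ), 0 < derivWithin G (Set.Ici 0) x)
    (hGle : ∀ x ∈ Set.Ici (0 : ℝ), 0 ≤ G x ∧ G x ≤ x)
    (hfe : ∀ x ∈ Set.Ici (0 : ℝ), G (2 * x) = 2 * G (G x)) :
    ∀ x₀ : ℝ, 0 < x₀ → Tendsto (fun j : ℕ => G^[j] x₀) atTop (nhds 0) →
      iteratedDeriv 3 G x₀ / deriv G x₀
        - (3 / 2) * (iteratedDeriv 2 G x₀ / deriv G x₀) ^ 2 = 0 := by
  intro x₀ hx₀ _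
  set g₁ := derivWithin G (Ici 0)
  set g₂ := derivWithin g₁ (Ici 0)
  set g₃ := derivWithin g₂ (Ici 0)
  have c₁ : ContDiffOn ℝ 2 g₁ (Ici 0) :=
    hGdiff.derivWithin (uniqueDiffOn_Ici 0) (by norm_num)
  have c₂ : ContDiffOn ℝ 1 g₂ (Ici 0) := c₁.derivWithin (uniqueDiffOn_Ici 0) (by norm_num)
  have c₃ : ContDiffOn ℝ 0 g₃ (Ici 0) := c₂.derivWithin (uniqueDiffOn_Ici 0) (by norm_num)
  have h₁ : ∀ x > 0, HasDerivAt G (g₁ x) x := fun x hx =>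
    hGdiff.hasDerivAt_derivWithin_Ici (by norm_num) hx
  have h₂ : ∀ x > 0, HasDerivAt g₁ (g₂ x) x := fun x hx =>
    c₁.hasDerivAt_derivWithin_Ici (by norm_num) hx
  have h₃ : ∀ x > 0, HasDerivAt g₂ (g₃ x) x := fun x hx =>
    c₂.hasDerivAt_derivWithin_Ici (by norm_num) hx
  have hmono : StrictMonoOn G (Ici 0) := by
    refine strictMonoOn_of_deriv_pos (convex_Ici 0) hGdiff.continuousOn fun x hx => ?_
    rw [interior_Ici] at hx
    rw [(h₁ x hx).deriv]
    exact hG' x (mem_Ici.2 (mem_Ioi.1 hx).le)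
  have hGpos : ∀ x > 0, 0 < G x := fun x hx => by
    simpa [hG0] using hmono (mem_Ici.2 le_rfl) (mem_Ici.2 hx.le) hx
  let s : ℝ → ℝ := fun x => g₃ x / g₁ x - (3 / 2) * (g₂ x / g₁ x) ^ 2
  have hs : ContinuousOn s (Ici 0) := by
    have hne : ∀ x ∈ Ici (0 : ℝ), g₁ x ≠ 0 := fun x hx => (hG' x hx).ne'
    exact (c₃.continuousOn.div c₁.continuousOn hne).sub
      (continuousOn_const.mul ((c₂.continuousOn.div c₁.continuousOn hne).pow 2))
  obtain ⟨M, hM⟩ := isCompact_Icc.exists_bound_of_continuousOn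
    (hs.mono (Icc_subset_Ici_self : Icc (0 : ℝ) 1 ⊆ Ici 0))
  have hev : ∀ᶠ x in 𝓝[≥] (0 : ℝ), g₁ x ^ 2 < 2 :=
    ((c₁.continuousOn 0 (mem_Ici.2 le_rfl)).pow 2).eventually_lt_const (by norm_num [hG'0])
  obtain ⟨a, ha, hac⟩ := mem_nhdsGE_iff_exists_Icc_subset.1 hev
  have hzero : s x₀ = 0 :=
    eq_zero_of_doubling (s := s) (G := G) (c := g₁) (lt_min ha one_pos)
      (fun x hx => ⟨hGpos x hx, (hGle x hx.le).2⟩)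
      (fun x hx => schwarzian_doubling h₁ h₂ h₃ (fun x hx => hG' x hx.le) hGpos
        (fun x hx => hfe x hx.le) hx)
      (fun x hx hxa => hM x ⟨hx.le, hxa.trans (min_le_right _ _)⟩)
      (fun x hx hxa => (hac ⟨hx.le, hxa.trans (min_le_left _ _)⟩).le) x₀ hx₀
  have hd₁ : ∀ x > 0, deriv G x = g₁ x := fun x hx => (h₁ x hx).deriv
  have hd₂ : ∀ x > 0, iteratedDeriv 2 G x = g₂ x := fun x hx => by
    rw [iteratedDeriv_succ, iteratedDeriv_one]
    have h : deriv G =ᶠ[𝓝 x] g₁ := (eventually_gt_nhds hx).mono hd₁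
    exact h.deriv_eq.trans (h₂ x hx).deriv
  have hd₃ : iteratedDeriv 3 G x₀ = g₃ x₀ := by
    rw [iteratedDeriv_succ]
    have h : iteratedDeriv 2 G =ᶠ[𝓝 x₀] g₂ := (eventually_gt_nhds hx₀).mono hd₂
    exact h.deriv_eq.trans (h₃ x₀ hx₀).deriv
  rw [hd₁ x₀ hx₀, hd₂ x₀ hx₀, hd₃]
  exact hzero

end
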